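/- arXiv:1507.01154 — 2 statements merged into one kernel-verified Lean document; each statement's English description precedes it below -/
import Mathlib

section
/- Let L and Q be n×n real symmetric positive semidefinite matrices such that L − Q is positive semidefinite. Then det(L + I) ≤ det(L − Q + I) · det(Q + I), where I is the n×n identity matrix. -/
open Matrix

namespace Matrix

variable {n : Type*} [Fintype n] [DecidableEq n]

theorem PosSemidef.exists_eq_conjTranspose_mul_self {A : Matrix n n ℝ} (hA : A.PosSemidef) :
    ∃ B : Matrix n n ℝ, A = Bᴴ * B := by
  open scoped MatrixOrder in
  exact CStarAlgebra.nonneg_iff_eq_star_mul_self.mp (nonneg_iff_posSemidef.mpr hA)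

theorem PosSemidef.one_le_det_one_add {A : Matrix n n ℝ} (hA : A.PosSemidef) :
    1 ≤ (1 + A).det := by
  have h : (1 + A).det = ∏ i, (1 + hA.1.eigenvalues i) := by
    have h1 : (-(1 + A)).det = ∏ i, -(1 + hA.1.eigenvalues i) := by
      have h2 := congrArg (Polynomial.eval (-1)) hA.1.charpoly_eq
      have hd : (diagonal fun _ : n => (-1 : ℝ)) = -1 := by rw [← diagonal_one, diagonal_neg]
      simpa [eval_charpoly, Polynomial.eval_prod, hd, neg_add_rev, sub_eq_add_neg, add_comm] using h2
    rw [det_neg, Finset.prod_neg] at h1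
    exact mul_left_cancel₀ (pow_ne_zero _ (by norm_num)) h1
  rw [h]
  exact Finset.one_le_prod fun i _ => le_add_of_nonneg_right (hA.eigenvalues_nonneg i)

/-- The determinant is monotone for the Loewner order above a positive definite matrix. -/
theorem PosDef.det_le_det_of_posSemidef_sub {A B : Matrix n n ℝ} (hA : A.PosDef)
    (h : (B - A).PosSemidef) : A.det ≤ B.det := by
  obtain ⟨C, hC⟩ := h.exists_eq_conjTranspose_mul_self
  rw [← add_sub_cancel A B, hC, det_add_mul _ _ hA.det_pos.ne'.isUnit]
  exact le_mul_of_one_le_right hA.det_pos.le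
    (hA.inv.posSemidef.mul_mul_conjTranspose_same C).one_le_det_one_add

theorem PosSemidef.one_sub_inv_add_one {A : Matrix n n ℝ} (hA : A.PosSemidef) :
    (1 - (A + 1)⁻¹).PosSemidef := by
  have hS : (A + 1).PosDef := PosDef.posSemidef_add hA PosDef.one
  have hu : IsUnit (A + 1).det := hS.det_pos.ne'.isUnit
  have h : 1 - (A + 1)⁻¹ = (A + 1)⁻¹ * (Aᴴ * A + A) * ((A + 1)⁻¹)ᴴ := by
    have h1 : Aᴴ * A + A = (A + 1) * (A + 1) - (A + 1) := by rw [hA.1.eq]; noncomm_ring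
    rw [h1, hS.inv.1.eq, mul_sub, sub_mul, nonsing_inv_mul_cancel_left _ _ hu,
      nonsing_inv_mul _ hu, mul_nonsing_inv _ hu, one_mul]
  rw [h]
  exact ((posSemidef_conjTranspose_mul_self A).add hA).mul_mul_conjTranspose_same _

theorem PosSemidef.det_add_add_one_le {A B : Matrix n n ℝ} (hA : A.PosSemidef)
    (hB : B.PosSemidef) : (A + B + 1).det ≤ (A + 1).det * (B + 1).det := by
  obtain ⟨C, rfl⟩ := hA.exists_eq_conjTranspose_mul_self
  have hS : (B + 1).PosDef := PosDef.posSemidef_add hB PosDef.one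
  rw [add_assoc, add_comm, det_add_mul _ _ hS.det_pos.ne'.isUnit, mul_comm, det_mul_add_one_comm,
    add_comm (C * Cᴴ)]
  refine mul_le_mul_of_nonneg_right (PosDef.det_le_det_of_posSemidef_sub ?_ ?_) hS.det_pos.le
  · exact PosDef.one.add_posSemidef (hS.inv.posSemidef.mul_mul_conjTranspose_same C)
  · have h : 1 + C * Cᴴ - (1 + C * (B + 1)⁻¹ * Cᴴ) = C * (1 - (B + 1)⁻¹) * Cᴴ := by noncomm_ring
    exact h ▸ hB.one_sub_inv_add_one.mul_mul_conjTranspose_same C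

end Matrix

/-- Key determinant inequality (equation (e:tool1)) in the proof of Proposition 1:
for positive semidefinite `L`, `Q` with `L - Q` positive semidefinite,
`det(L + I) ≤ det(L - Q + I) det(Q + I)`. -/
theorem stmt_1 {n : ℕ} (L Q : Matrix (Fin n) (Fin n) ℝ) (hL : L.PosSemidef)
    (hQ : Q.PosSemidef) (hLQ : (L - Q).PosSemidef) :
    (L + 1).det ≤ (L - Q + 1).det * (Q + 1).det := by
  simpa using hLQ.det_add_add_one_le hQ
end

section
/- Let L be an n×n real symmetric positive definite matrix, B an n×m real matrix, and C an m×m real symmetric positive definite matrix such that the block matrix [[L, B], [Bᵀ, C]] is positive semidefinite; set Q = B C⁻¹ Bᵀ. Let Y₁, …, Y_T be nonempty subsets of {1, …, n}, and for each t let L_{Y_t} denote the principal submatrix of L indexed by Y_t. Then Σ_{t=1}^T log det(L_{Y_t}) − T·log det(Q + I) − T·tr(L − Q) ≤ Σ_{t=1}^T log det(L_{Y_t}) − T·log det(L + I). -/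
open Matrix

namespace Matrix

variable {ι : Type*} [Fintype ι] [DecidableEq ι]

/-- `log det P ≤ tr (P - I)` for a positive definite matrix `P`. -/
theorem PosDef.log_det_le_trace_sub_one {P : Matrix ι ι ℝ} (hP : P.PosDef) :
    Real.log P.det ≤ (P - 1).trace := by
  rw [hP.isHermitian.det_eq_prod_eigenvalues, trace_sub,
    hP.isHermitian.trace_eq_sum_eigenvalues, trace_one]
  simp only [RCLike.ofReal_real_eq_id, id]
  rw [Real.log_prod fun i _ => (hP.eigenvalues_pos i).ne']
  calc ∑ i, Real.log (hP.isHermitian.eigenvalues i)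
      ≤ ∑ i, (hP.isHermitian.eigenvalues i - 1) :=
        Finset.sum_le_sum fun i _ => Real.log_le_sub_one_of_pos (hP.eigenvalues_pos i)
    _ = _ := by simp

/-- `(Q + I)⁻¹ ≤ I` in the Loewner order for a positive semidefinite matrix `Q`. -/
theorem PosSemidef.one_sub_inv_add_one_s5 {Q : Matrix ι ι ℝ} (hQ : Q.PosSemidef) :
    (1 - (Q + 1)⁻¹).PosSemidef := by
  have hQ1 : (Q + 1).PosDef := PosDef.posSemidef_add hQ .one
  let : Invertible (Q + 1) := hQ1.isUnit.invertible
  let : Invertible (1 : Matrix ι ι ℝ) := invertibleOne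
  have h := (PosDef.fromBlocks₁₁ (1 : Matrix ι ι ℝ) (Q + 1) .one).2 (by simpa using hQ)
  simpa using (PosDef.fromBlocks₂₂ _ _ hQ1).1 h

open scoped MatrixOrder in
/-- The function `L ↦ log det (L + I) - tr L` is antitone for the Loewner order on positive
semidefinite matrices. -/
theorem PosSemidef.log_det_add_one_le {L Q : Matrix ι ι ℝ} (hQ : Q.PosSemidef)
    (hLQ : (L - Q).PosSemidef) :
    Real.log (L + 1).det ≤ Real.log (Q + 1).det + (L - Q).trace := by
  have hQ1 : (Q + 1).PosDef := PosDef.posSemidef_add hQ .one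
  obtain ⟨R, hR⟩ := CStarAlgebra.nonneg_iff_eq_star_mul_self.mp hLQ.nonneg
  rw [star_eq_conjTranspose] at hR
  have hP : (1 + R * (Q + 1)⁻¹ * Rᴴ).PosDef :=
    PosDef.one.add_posSemidef (hQ1.inv.posSemidef.mul_mul_conjTranspose_same R)
  have hdet : (L + 1).det = (Q + 1).det * (1 + R * (Q + 1)⁻¹ * Rᴴ).det := by
    rw [← det_add_mul _ _ hQ1.det_pos.ne'.isUnit, ← hR]
    congr 1
    abel
  have htr := (hQ.one_sub_inv_add_one_s5.mul_mul_conjTranspose_same R).trace_nonneg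
  rw [mul_sub, sub_mul, mul_one, trace_sub, trace_mul_comm R, ← hR] at htr
  have hlog := hP.log_det_le_trace_sub_one
  rw [add_sub_cancel_left] at hlog
  rw [hdet, Real.log_mul hQ1.det_pos.ne' hP.det_pos.ne']
  linarith

end Matrix

/-- The variational lower bound (equation (8) of the paper) on the DPP log
likelihood: `F(θ, Z) ≤ ℓ(θ)`, where `Q = B C⁻¹ Bᵀ` is the Nyström-type matrix
built from pseudo-inputs. -/
theorem stmt_5 {n m T : ℕ} (L : Matrix (Fin n) (Fin n) ℝ) (B : Matrix (Fin n) (Fin m) ℝ)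
    (C : Matrix (Fin m) (Fin m) ℝ) (hL : L.PosDef) (hC : C.PosDef)
    (hblock : (Matrix.fromBlocks L B Bᵀ C).PosSemidef)
    (Y : Fin T → Finset (Fin n)) (hY : ∀ t, (Y t).Nonempty) :
    (∑ t, Real.log
        ((L.submatrix (fun i : Y t => (i : Fin n)) (fun i : Y t => (i : Fin n))).det))
      - T * Real.log ((B * C⁻¹ * Bᵀ + 1).det) - T * (L - B * C⁻¹ * Bᵀ).trace
    ≤ (∑ t, Real.log
        ((L.submatrix (fun i : Y t => (i : Fin n)) (fun i : Y t => (i : Fin n))).det))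
      - T * Real.log ((L + 1).det) := by
  let : Invertible C := hC.isUnit.invertible
  have hQ : (B * C⁻¹ * Bᵀ).PosSemidef := by
    simpa using hC.inv.posSemidef.mul_mul_conjTranspose_same B
  have hLQ : (L - B * C⁻¹ * Bᵀ).PosSemidef := by
    simpa using (PosDef.fromBlocks₂₂ L B hC).1 (by simpa using hblock)
  have h := mul_le_mul_of_nonneg_left (hQ.log_det_add_one_le hLQ) (Nat.cast_nonneg (α := ℝ) T)
  rw [mul_add] at h
  linarith
end
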